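/- arXiv:1508.07309 — 2 statements merged into one kernel-verified Lean document; each statement's English description precedes it below -/
import Mathlib

section
/- There is an absolute constant C > 0 such that for every integer a, every integer s ≥ 1, every real R ≥ 1, and all reals x, y with a ≤ y ≤ x and y ≥ 0, one has | Σ_{y < n ≤ x, n ≡ a (mod s)} F_R(n) − ((x−y)/s) · Σ_{r ≤ R, r | s} μ(r)² · μ(gcd(r,a)) · φ(gcd(r,a)) / φ(r) | ≤ C·R, where n runs over positive integers and r over positive integers dividing s. -/
open Finset Real

/-- Vaughan's function `F_R(n) = ∑_{r ≤ R} μ(r)² μ((r,n)) φ((r,n)) / φ(r)`. -/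
noncomputable def FR (R : ℝ) (n : ℤ) : ℝ :=
  ∑ r ∈ Finset.Icc 1 ⌊R⌋₊,
    (ArithmeticFunction.moebius r : ℝ) ^ 2 *
      (ArithmeticFunction.moebius (Int.gcd (r : ℤ) n) : ℝ) *
      (Nat.totient (Int.gcd (r : ℤ) n) : ℝ) / (Nat.totient r : ℝ)

/-- `ρ_R^*(x;q,a) = ∑_{n ≤ x, n ≡ a (q), n > a} F_R(n)`. -/
noncomputable def rhoStar (R x : ℝ) (q : ℕ) (a : ℤ) : ℝ :=
  ∑ n ∈ (Finset.Icc 1 ⌊x⌋₊).filter (fun n : ℕ => a < (n : ℤ) ∧ (q : ℤ) ∣ (n : ℤ) - a),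
    FR R n

/-- `ψ^*(x;q,a) = ∑_{n ≤ x, n ≡ a (q), n > a} Λ(n)`. -/
noncomputable def psiStar (x : ℝ) (q : ℕ) (a : ℤ) : ℝ :=
  ∑ n ∈ (Finset.Icc 1 ⌊x⌋₊).filter (fun n : ℕ => a < (n : ℤ) ∧ (q : ℤ) ∣ (n : ℤ) - a),
    ArithmeticFunction.vonMangoldt n

/-- `d ↦ gcd(d, s)` if this gcd divides `a`, and `0` otherwise. -/
noncomputable def gcdIndicator (s : ℕ) (a : ℤ) : ArithmeticFunction ℝ where
  toFun d := if d ≠ 0 ∧ ((d.gcd s : ℕ) : ℤ) ∣ a then (d.gcd s : ℝ) else 0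
  map_zero' := by simp

lemma gcdIndicator_apply (s : ℕ) (a : ℤ) {d : ℕ} (hd : d ≠ 0) :
    gcdIndicator s a d = if ((d.gcd s : ℕ) : ℤ) ∣ a then (d.gcd s : ℝ) else 0 := by
  simp [gcdIndicator, hd]

lemma isMultiplicative_gcdIndicator (s : ℕ) (a : ℤ) : (gcdIndicator s a).IsMultiplicative := by
  rw [ArithmeticFunction.IsMultiplicative.iff_ne_zero]
  refine ⟨by simp [gcdIndicator], fun {m n} hm hn hmn => ?_⟩
  rw [gcdIndicator_apply s a (mul_ne_zero hm hn), gcdIndicator_apply s a hm,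
    gcdIndicator_apply s a hn]
  have hgcd : (m * n).gcd s = m.gcd s * n.gcd s := by
    rw [Nat.gcd_comm, Nat.Coprime.gcd_mul s hmn, Nat.gcd_comm s m, Nat.gcd_comm s n]
  have hcop : IsCoprime ((m.gcd s : ℕ) : ℤ) ((n.gcd s : ℕ) : ℤ) :=
    Nat.isCoprime_iff_coprime.2 (by simpa only [Nat.gcd_comm s] using hmn.gcd_both s s)
  have hdvd : (((m * n).gcd s : ℕ) : ℤ) ∣ a ↔
      ((m.gcd s : ℕ) : ℤ) ∣ a ∧ ((n.gcd s : ℕ) : ℤ) ∣ a := by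
    rw [hgcd, Nat.cast_mul]
    exact ⟨fun h => ⟨dvd_of_mul_right_dvd h, dvd_of_mul_left_dvd h⟩,
      fun h => hcop.mul_dvd h.1 h.2⟩
  simp only [hdvd]
  by_cases h₁ : ((m.gcd s : ℕ) : ℤ) ∣ a <;> by_cases h₂ : ((n.gcd s : ℕ) : ℤ) ∣ a <;>
    simp [h₁, h₂, hgcd]

lemma totient_eq_prod_primeFactors_of_squarefree {n : ℕ} (hn : Squarefree n) :
    (n.totient : ℝ) = ∏ p ∈ n.primeFactors, ((p : ℝ) - 1) := by
  have h := Nat.totient_mul_prod_primeFactors n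
  rw [Nat.prod_primeFactors_of_squarefree hn, mul_comm] at h
  rw [Nat.eq_of_mul_eq_mul_left (Nat.pos_of_ne_zero hn.ne_zero) h, Nat.cast_prod]
  refine prod_congr rfl fun p hp => ?_
  rw [Nat.cast_sub (Nat.prime_of_mem_primeFactors hp).one_le, Nat.cast_one]

lemma moebius_mul_totient_of_squarefree {n : ℕ} (hn : Squarefree n) :
    (ArithmeticFunction.moebius n : ℝ) * n.totient =
      ∑ d ∈ n.divisors, (ArithmeticFunction.moebius d : ℝ) * d := by
  have h₁ := (ArithmeticFunction.isMultiplicative_id.natCast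
    (R := ℝ)).prodPrimeFactors_one_sub_of_squarefree _ hn
  have h₂ := ArithmeticFunction.isMultiplicative_moebius.prod_primeFactors hn
  simp only [ArithmeticFunction.natCoe_apply, ArithmeticFunction.id_apply] at h₁
  rw [← h₁, ← h₂, totient_eq_prod_primeFactors_of_squarefree hn, Int.cast_prod, ← prod_mul_distrib]
  refine prod_congr rfl fun p hp => ?_
  rw [ArithmeticFunction.moebius_apply_prime (Nat.prime_of_mem_primeFactors hp)]
  push_cast
  ring

lemma moebius_mul_totient_gcd {r : ℕ} (hr : Squarefree r) (n : ℤ) :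
    (ArithmeticFunction.moebius (Int.gcd r n) : ℝ) * (Int.gcd r n).totient =
      ∑ d ∈ r.divisors, (ArithmeticFunction.moebius d : ℝ) * d * if (d : ℤ) ∣ n then 1 else 0 := by
  have hdvd : Int.gcd r n ∣ r := by exact_mod_cast Int.gcd_dvd_left (a := (r : ℤ)) (b := n)
  rw [moebius_mul_totient_of_squarefree (hr.squarefree_of_dvd hdvd)]
  simp only [mul_ite, mul_one, mul_zero]
  rw [← sum_filter]
  refine sum_congr ?_ fun _ _ => rfl
  ext d
  have h0 := hr.ne_zero
  simp only [Nat.mem_divisors, mem_filter, ne_eq, h0, not_false_eq_true, and_true]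
  rw [← Int.natCast_dvd_natCast, Int.dvd_coe_gcd_iff, Int.natCast_dvd_natCast]
  simp [Int.gcd_eq_zero_iff, h0]

lemma sum_moebius_mul_gcdIndicator {r s : ℕ} (hr : Squarefree r) (hs : s ≠ 0) (a : ℤ) :
    ∑ d ∈ r.divisors, (ArithmeticFunction.moebius d : ℝ) * gcdIndicator s a d =
      if r ∣ s then (ArithmeticFunction.moebius (Int.gcd r a) : ℝ) * (Int.gcd r a).totient
      else 0 := by
  split_ifs with h
  · rw [moebius_mul_totient_gcd hr]
    refine sum_congr rfl fun d hd => ?_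
    have hdr := Nat.dvd_of_mem_divisors hd
    rw [gcdIndicator_apply s a (Nat.pos_of_mem_divisors hd).ne',
      Nat.gcd_eq_left (hdr.trans h)]
    split_ifs <;> ring
  · rw [← (isMultiplicative_gcdIndicator s a).prodPrimeFactors_one_sub_of_squarefree _ hr]
    obtain ⟨p, hp, hps⟩ : ∃ p ∈ r.primeFactors, ¬ p ∣ s := by
      by_contra! hall
      refine h ?_
      rw [← Nat.prod_primeFactors_of_squarefree hr]
      exact (prod_dvd_prod_of_subset _ _ _ fun p hp => Nat.mem_primeFactors.2
        ⟨Nat.prime_of_mem_primeFactors hp, hall p hp, hs⟩).trans (Nat.prod_primeFactors_dvd s)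
    refine prod_eq_zero hp ?_
    have hpp := Nat.prime_of_mem_primeFactors hp
    have hone : p.gcd s = 1 := (Nat.Prime.coprime_iff_not_dvd hpp).2 hps
    rw [gcdIndicator_apply s a hpp.ne_zero]
    simp [hone]

lemma abs_card_Ioc_modEq_sub_le {x y : ℝ} (hy : 0 ≤ y) (hyx : y ≤ x) {m : ℕ} (hm : 0 < m) (v : ℕ) :
    |(((Finset.Ioc ⌊y⌋₊ ⌊x⌋₊).filter (fun n : ℕ => n ≡ v [MOD m])).card : ℝ) - (x - y) / m|
      ≤ 2 := by
  have hcard := Nat.Ioc_filter_modEq_card ⌊y⌋₊ ⌊x⌋₊ hm v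
  have hfl : ⌊y⌋₊ ≤ ⌊x⌋₊ := Nat.floor_mono hyx
  have hmQ : (0 : ℚ) < m := by exact_mod_cast hm
  have hle : ((⌊y⌋₊ : ℚ) - v) / m ≤ ((⌊x⌋₊ : ℚ) - v) / m := by
    gcongr
  rw [max_eq_left (sub_nonneg.2 (Int.floor_mono hle))] at hcard
  have hcardQ : ((((Finset.Ioc ⌊y⌋₊ ⌊x⌋₊).filter (fun n : ℕ => n ≡ v [MOD m])).card : ℤ) : ℚ) =
      (⌊((⌊x⌋₊ : ℚ) - v) / m⌋ : ℚ) - (⌊((⌊y⌋₊ : ℚ) - v) / m⌋ : ℚ) := by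
    rw [hcard]; push_cast; rfl
  set N := ((Finset.Ioc ⌊y⌋₊ ⌊x⌋₊).filter (fun n : ℕ => n ≡ v [MOD m])).card
  have hdiff : ((⌊x⌋₊ : ℚ) - v) / m - ((⌊y⌋₊ : ℚ) - v) / m = ((⌊x⌋₊ : ℚ) - ⌊y⌋₊) / m := by ring
  have hupQ : (N : ℚ) - ((⌊x⌋₊ : ℚ) - ⌊y⌋₊) / m ≤ 1 := by
    have := Int.floor_le (((⌊x⌋₊ : ℚ) - v) / m)
    have := Int.lt_floor_add_one (((⌊y⌋₊ : ℚ) - v) / m)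
    push_cast at hcardQ
    linarith
  have hloQ : -1 ≤ (N : ℚ) - ((⌊x⌋₊ : ℚ) - ⌊y⌋₊) / m := by
    have := Int.floor_le (((⌊y⌋₊ : ℚ) - v) / m)
    have := Int.lt_floor_add_one (((⌊x⌋₊ : ℚ) - v) / m)
    push_cast at hcardQ
    linarith
  have hup : (N : ℝ) - ((⌊x⌋₊ : ℝ) - ⌊y⌋₊) / m ≤ 1 := by
    simpa using (Rat.cast_le (K := ℝ)).2 hupQ
  have hlo : -1 ≤ (N : ℝ) - ((⌊x⌋₊ : ℝ) - ⌊y⌋₊) / m := by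
    simpa using (Rat.cast_le (K := ℝ)).2 hloQ
  have hm1 : (1 : ℝ) ≤ m := by exact_mod_cast hm
  have hfrac : |((⌊x⌋₊ : ℝ) - ⌊y⌋₊) - (x - y)| ≤ 1 := by
    have := Nat.floor_le hy
    have := Nat.floor_le (hy.trans hyx)
    have := Nat.lt_floor_add_one x
    have := Nat.lt_floor_add_one y
    rw [abs_le]; constructor <;> linarith
  have hround : |((⌊x⌋₊ : ℝ) - ⌊y⌋₊) / m - (x - y) / m| ≤ 1 := by
    rw [← sub_div, abs_div, Nat.abs_cast]
    exact (div_le_self (abs_nonneg _) hm1).trans hfrac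
  rw [abs_le] at hround ⊢
  constructor <;> linarith [hround.1, hround.2]

lemma abs_card_Ioc_dvd_sub_le {x y : ℝ} (hy : 0 ≤ y) (hyx : y ≤ x) {d s : ℕ} (hd : d ≠ 0)
    (hs : s ≠ 0) (a : ℤ) :
    |(((Finset.Ioc ⌊y⌋₊ ⌊x⌋₊).filter
          (fun n : ℕ => (s : ℤ) ∣ (n : ℤ) - a ∧ (d : ℤ) ∣ (n : ℤ))).card : ℝ)
        - (x - y) / s * (gcdIndicator s a d / d)| ≤ 2 := by
  rw [gcdIndicator_apply s a hd]
  split_ifs with h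
  · have hsZ : (s : ℤ) ≠ 0 := by exact_mod_cast hs
    obtain ⟨b, hb⟩ := Int.eq_ofNat_of_zero_le (Int.emod_nonneg a hsZ)
    have hsb : (s : ℤ) ∣ a - b := by
      have := Int.emod_add_mul_ediv a s
      exact ⟨a / s, by linarith⟩
    have hcompat : 0 ≡ b [MOD d.gcd s] := by
      have : ((d.gcd s : ℕ) : ℤ) ∣ b := by
        have h₁ : ((d.gcd s : ℕ) : ℤ) ∣ a - b :=
          (Int.natCast_dvd_natCast.2 (Nat.gcd_dvd_right d s)).trans hsb
        simpa using dvd_sub h h₁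
      exact (Nat.modEq_zero_iff_dvd.2 (by exact_mod_cast this)).symm
    obtain ⟨v, hv₁, hv₂⟩ := Nat.chineseRemainder' hcompat
    have hiff : ∀ n : ℕ, ((s : ℤ) ∣ (n : ℤ) - a ∧ (d : ℤ) ∣ (n : ℤ)) ↔
        n ≡ v [MOD d.lcm s] := by
      intro n
      have e₁ : (s : ℤ) ∣ (n : ℤ) - a ↔ n ≡ b [MOD s] := by
        rw [Nat.ModEq.comm, Nat.modEq_iff_dvd,
          show (n : ℤ) - b = ((n : ℤ) - a) + (a - b) by ring, dvd_add_left hsb]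
      have e₂ : (d : ℤ) ∣ (n : ℤ) ↔ n ≡ 0 [MOD d] := by
        rw [Nat.modEq_zero_iff_dvd, Int.natCast_dvd_natCast]
      rw [e₁, e₂]
      constructor
      · rintro ⟨h₁, h₂⟩
        have k₁ := (Nat.modEq_iff_dvd.1 (h₂.trans hv₁.symm))
        have k₂ := (Nat.modEq_iff_dvd.1 (h₁.trans hv₂.symm))
        rw [Nat.modEq_iff_dvd]
        have := Int.coe_lcm_dvd k₁ k₂
        simpa using this
      · intro hn
        exact ⟨(hn.of_dvd (Nat.dvd_lcm_right d s)).trans hv₂,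
          (hn.of_dvd (Nat.dvd_lcm_left d s)).trans hv₁⟩
    simp only [hiff]
    have hlcm : ((d.gcd s : ℕ) : ℝ) * (d.lcm s : ℕ) = d * s := by
      exact_mod_cast Nat.gcd_mul_lcm d s
    have hpos : 0 < d.lcm s := Nat.lcm_pos (Nat.pos_of_ne_zero hd) (Nat.pos_of_ne_zero hs)
    have hposR : ((d.lcm s : ℕ) : ℝ) ≠ 0 := by exact_mod_cast hpos.ne'
    have hdR : (d : ℝ) ≠ 0 := by exact_mod_cast hd
    have hsR : (s : ℝ) ≠ 0 := by exact_mod_cast hs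
    have hmain : (x - y) / s * (((d.gcd s : ℕ) : ℝ) / d) = (x - y) / (d.lcm s : ℕ) := by
      field_simp
      rw [mul_assoc, hlcm]
      ring
    rw [hmain]
    exact abs_card_Ioc_modEq_sub_le hy hyx hpos v
  · have hempty : (Finset.Ioc ⌊y⌋₊ ⌊x⌋₊).filter
        (fun n : ℕ => (s : ℤ) ∣ (n : ℤ) - a ∧ (d : ℤ) ∣ (n : ℤ)) = ∅ := by
      refine filter_eq_empty_iff.2 fun n _ ⟨h₁, h₂⟩ => h ?_
      have k₁ := (Int.natCast_dvd_natCast.2 (Nat.gcd_dvd_right d s)).trans h₁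
      have k₂ := (Int.natCast_dvd_natCast.2 (Nat.gcd_dvd_left d s)).trans h₂
      simpa using dvd_sub k₂ k₁
    simp [hempty]

lemma sum_two_div_mul_sub_one_le (N : ℕ) :
    ∑ n ∈ Finset.Icc 2 N, 2 / ((n : ℝ) * (n - 1)) ≤ 2 := by
  have key : ∀ N : ℕ, 1 ≤ N → ∑ n ∈ Finset.Icc 2 N, 2 / ((n : ℝ) * (n - 1)) = 2 - 2 / N := by
    intro N hN
    induction N, hN using Nat.le_induction with
    | base => simp
    | succ k hk ih =>
      have hk0 : (k : ℝ) ≠ 0 := by exact_mod_cast (by omega : k ≠ 0)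
      have hk1 : (k : ℝ) + 1 ≠ 0 := by positivity
      rw [sum_Icc_succ_top (by omega), ih]
      push_cast
      rw [add_sub_cancel_right]
      field_simp
      ring
  rcases Nat.eq_zero_or_pos N with rfl | hN
  · simp
  · rw [key N hN]
    have : (0 : ℝ) ≤ 2 / N := by positivity
    linarith

lemma sum_prod_primeFactors_one_add_le (N : ℕ) :
    ∑ r ∈ Finset.Icc 1 N, ∏ p ∈ r.primeFactors, (1 + 2 / ((p : ℝ) - 1)) ≤ Real.exp 2 * N := by
  set P := (Finset.Icc 2 N).filter Nat.Prime
  have hprime : ∀ p ∈ P, p.Prime := fun p hp => (mem_filter.1 hp).2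
  have hnonneg : ∀ p : ℕ, p.Prime → (0 : ℝ) ≤ 2 / ((p : ℝ) - 1) := fun p hp => by
    have : (1 : ℝ) ≤ p := by exact_mod_cast hp.one_le
    exact div_nonneg zero_le_two (by linarith)
  have hexpand : ∀ r ∈ Finset.Icc 1 N, ∏ p ∈ r.primeFactors, (1 + 2 / ((p : ℝ) - 1)) =
      ∑ t ∈ P.powerset, if ∏ p ∈ t, p ∣ r then ∏ p ∈ t, 2 / ((p : ℝ) - 1) else 0 := by
    intro r hr
    obtain ⟨hr1, hrN⟩ := mem_Icc.1 hr
    rw [prod_one_add, ← sum_filter]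
    refine sum_congr ?_ fun _ _ => rfl
    ext t
    simp only [mem_powerset, mem_filter]
    constructor
    · intro ht
      refine ⟨fun p hp => ?_, (prod_dvd_prod_of_subset _ _ _ ht).trans
        (Nat.prod_primeFactors_dvd r)⟩
      have := Nat.mem_primeFactors.1 (ht hp)
      exact mem_filter.2 ⟨mem_Icc.2 ⟨this.1.two_le, (Nat.le_of_dvd hr1 this.2.1).trans hrN⟩, this.1⟩
    · rintro ⟨ht, hdvd⟩ p hp
      exact Nat.mem_primeFactors.2 ⟨hprime p (ht hp), (dvd_prod_of_mem _ hp).trans hdvd, by omega⟩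
  rw [sum_congr rfl hexpand, sum_comm]
  have hbound : ∀ t ∈ P.powerset,
      ∑ r ∈ Finset.Icc 1 N, (if ∏ p ∈ t, p ∣ r then ∏ p ∈ t, 2 / ((p : ℝ) - 1) else 0) ≤
        N * ∏ p ∈ t, 2 / ((p : ℝ) * (p - 1)) := by
    intro t ht
    have ht := mem_powerset.1 ht
    have hcard : (((Finset.Icc 1 N).filter (fun r => ∏ p ∈ t, p ∣ r)).card : ℝ) ≤
        N / ∏ p ∈ t, (p : ℝ) := by
      have := Nat.Ioc_filter_dvd_card_eq_div N (∏ p ∈ t, p)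
      rw [show Finset.Icc 1 N = Finset.Ioc 0 N from rfl, this]
      exact Nat.cast_div_le.trans (by push_cast; rfl)
    rw [← sum_filter, sum_const, nsmul_eq_mul]
    calc _ ≤ (N / ∏ p ∈ t, (p : ℝ)) * ∏ p ∈ t, 2 / ((p : ℝ) - 1) :=
          mul_le_mul_of_nonneg_right hcard
            (prod_nonneg fun p hp => hnonneg p (hprime p (ht hp)))
      _ = _ := by
          simp only [prod_div_distrib, prod_mul_distrib]
          ring
  refine (sum_le_sum hbound).trans ?_
  rw [← mul_sum, ← prod_one_add, mul_comm]
  refine mul_le_mul_of_nonneg_right ?_ (Nat.cast_nonneg N)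
  have hterm : ∀ n : ℕ, (0 : ℝ) ≤ 2 / ((n : ℝ) * (n - 1)) := fun n => by
    rcases Nat.eq_zero_or_pos n with rfl | hn
    · simp
    · have : (1 : ℝ) ≤ n := by exact_mod_cast hn
      exact div_nonneg zero_le_two (mul_nonneg (by linarith) (by linarith))
  refine (Real.prod_one_add_le_exp_sum P hterm).trans (Real.exp_le_exp.2 ?_)
  exact (sum_le_sum_of_subset_of_nonneg (filter_subset _ _) fun n _ _ => hterm n).trans
    (sum_two_div_mul_sub_one_le N)

lemma sum_divisors_div_totient_of_squarefree {r : ℕ} (hr : Squarefree r) :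
    (∑ d ∈ r.divisors, (d : ℝ)) / r.totient =
      ∏ p ∈ r.primeFactors, (1 + 2 / ((p : ℝ) - 1)) := by
  have h := (ArithmeticFunction.isMultiplicative_id.natCast
    (R := ℝ)).prodPrimeFactors_one_add_of_squarefree hr
  simp only [ArithmeticFunction.natCoe_apply, ArithmeticFunction.id_apply] at h
  rw [← h, totient_eq_prod_primeFactors_of_squarefree hr, ← prod_div_distrib]
  refine prod_congr rfl fun p hp => ?_
  have : (1 : ℝ) < p := by exact_mod_cast (Nat.prime_of_mem_primeFactors hp).one_lt
  have : (p : ℝ) - 1 ≠ 0 := by linarith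
  field_simp
  ring

lemma abs_sum_moebius_mul_totient_gcd_sub_le {x y : ℝ} (hy : 0 ≤ y) (hyx : y ≤ x) {r s : ℕ}
    (hr : Squarefree r) (hs : s ≠ 0) (a : ℤ) :
    |(∑ n ∈ (Finset.Ioc ⌊y⌋₊ ⌊x⌋₊).filter (fun n : ℕ => (s : ℤ) ∣ (n : ℤ) - a),
        (ArithmeticFunction.moebius (Int.gcd r n) : ℝ) * (Int.gcd r n).totient)
      - (x - y) / s * (if r ∣ s then
          (ArithmeticFunction.moebius (Int.gcd r a) : ℝ) * (Int.gcd r a).totient else 0)|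
      ≤ 2 * ∑ d ∈ r.divisors, (d : ℝ) := by
  have hsum : ∑ n ∈ (Finset.Ioc ⌊y⌋₊ ⌊x⌋₊).filter (fun n : ℕ => (s : ℤ) ∣ (n : ℤ) - a),
        (ArithmeticFunction.moebius (Int.gcd r n) : ℝ) * (Int.gcd r n).totient =
      ∑ d ∈ r.divisors, (ArithmeticFunction.moebius d : ℝ) * d *
        ((Finset.Ioc ⌊y⌋₊ ⌊x⌋₊).filter
          (fun n : ℕ => (s : ℤ) ∣ (n : ℤ) - a ∧ (d : ℤ) ∣ (n : ℤ))).card := by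
    simp only [moebius_mul_totient_gcd hr]
    rw [sum_comm]
    refine sum_congr rfl fun d _ => ?_
    rw [← mul_sum, sum_boole, filter_filter]
  rw [hsum, ← sum_moebius_mul_gcdIndicator hr hs a, mul_sum, ← sum_sub_distrib, mul_sum]
  refine (abs_sum_le_sum_abs _ _).trans (sum_le_sum fun d hd => ?_)
  have hd0 : d ≠ 0 := (Nat.pos_of_mem_divisors hd).ne'
  have hdR : (d : ℝ) ≠ 0 := by exact_mod_cast hd0
  have hcount := abs_card_Ioc_dvd_sub_le hy hyx hd0 hs a
  set N := ((Finset.Ioc ⌊y⌋₊ ⌊x⌋₊).filter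
          (fun n : ℕ => (s : ℤ) ∣ (n : ℤ) - a ∧ (d : ℤ) ∣ (n : ℤ))).card
  have hfactor : (ArithmeticFunction.moebius d : ℝ) * d * N -
      (x - y) / s * ((ArithmeticFunction.moebius d : ℝ) * gcdIndicator s a d) =
      (ArithmeticFunction.moebius d : ℝ) * d *
        (N - (x - y) / s * (gcdIndicator s a d / d)) := by
    field_simp
  have hmu : |(ArithmeticFunction.moebius d : ℝ)| ≤ 1 := by
    exact_mod_cast ArithmeticFunction.abs_moebius_le_one (n := d)
  rw [hfactor, abs_mul, abs_mul, Nat.abs_cast, mul_comm]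
  exact mul_le_mul hcount (mul_le_of_le_one_left (Nat.cast_nonneg d) hmu) (by positivity)
    zero_le_two

/-- `F_R` summed over an arithmetic progression in an interval. -/
theorem additive_character_sum :
    ∃ C : ℝ, 0 < C ∧ ∀ a : ℤ, ∀ s : ℕ, 1 ≤ s → ∀ R : ℝ, 1 ≤ R →
      ∀ x y : ℝ, (a : ℝ) ≤ y → y ≤ x → 0 ≤ y →
      |(∑ n ∈ (Finset.Ioc ⌊y⌋₊ ⌊x⌋₊).filter (fun n : ℕ => (s : ℤ) ∣ (n : ℤ) - a),
            FR R (n : ℤ))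
          - ((x - y) / (s : ℝ)) *
              ∑ r ∈ (Finset.Icc 1 ⌊R⌋₊).filter (· ∣ s),
                (ArithmeticFunction.moebius r : ℝ) ^ 2 *
                  (ArithmeticFunction.moebius (Int.gcd (r : ℤ) a) : ℝ) *
                  (Nat.totient (Int.gcd (r : ℤ) a) : ℝ) / (Nat.totient r : ℝ)|
        ≤ C * R := by
  refine ⟨2 * Real.exp 2, by positivity, fun a s hs R hR x y _ hyx hy => ?_⟩
  have hs0 : s ≠ 0 := by omega
  set w : ℕ → ℝ := fun r => (ArithmeticFunction.moebius r : ℝ) ^ 2 / r.totient with hw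
  set T : ℕ → ℤ → ℝ := fun r n =>
    (ArithmeticFunction.moebius (Int.gcd r n) : ℝ) * (Int.gcd r n).totient with hT
  have hterm : ∀ (r : ℕ) (n : ℤ), (ArithmeticFunction.moebius r : ℝ) ^ 2 *
      (ArithmeticFunction.moebius (Int.gcd (r : ℤ) n) : ℝ) *
      (Nat.totient (Int.gcd (r : ℤ) n) : ℝ) / (Nat.totient r : ℝ) = w r * T r n :=
    fun r n => by simp only [hw, hT]; ring
  simp only [FR, hterm]
  rw [sum_comm, sum_filter, mul_sum, ← sum_sub_distrib]
  have hfloor : ((⌊R⌋₊ : ℕ) : ℝ) ≤ R := Nat.floor_le (by linarith)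
  calc _ ≤ ∑ r ∈ Finset.Icc 1 ⌊R⌋₊,
        2 * ∏ p ∈ r.primeFactors, (1 + 2 / ((p : ℝ) - 1)) := by
        refine (abs_sum_le_sum_abs _ _).trans (sum_le_sum fun r _ => ?_)
        by_cases hr : Squarefree r
        · have hpos : 0 < r.totient := Nat.totient_pos.2 (Nat.pos_of_ne_zero hr.ne_zero)
          have hwr : w r = 1 / r.totient := by
            have : (ArithmeticFunction.moebius r : ℝ) ^ 2 = 1 := by
              exact_mod_cast ArithmeticFunction.moebius_sq_eq_one_of_squarefree hr
            simp only [hw, this]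
          have hle := abs_sum_moebius_mul_totient_gcd_sub_le hy hyx hr hs0 a
          rw [← mul_sum, ← mul_ite_zero, mul_left_comm, ← mul_sub, abs_mul, hwr,
            abs_of_nonneg (by positivity), ← sum_divisors_div_totient_of_squarefree hr,
            one_div_mul_eq_div, ← mul_div_assoc]
          gcongr
        · have hwr : w r = 0 := by
            simp [hw, ArithmeticFunction.moebius_eq_zero_of_not_squarefree hr]
          simp only [hwr, zero_mul, sum_const_zero, ite_self, mul_zero, sub_zero, abs_zero]
          refine mul_nonneg zero_le_two (prod_nonneg fun p hp => ?_)
          have : (1 : ℝ) ≤ p := by exact_mod_cast (Nat.prime_of_mem_primeFactors hp).one_le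
          have : (0 : ℝ) ≤ 2 / ((p : ℝ) - 1) := div_nonneg zero_le_two (by linarith)
          linarith
    _ ≤ 2 * (Real.exp 2 * ⌊R⌋₊) := by
        rw [← mul_sum]
        gcongr
        exact sum_prod_primeFactors_one_add_le _
    _ ≤ 2 * Real.exp 2 * R := by
        rw [mul_assoc]
        gcongr
end

section
/- There is an absolute constant C > 0 such that for all reals x ≥ 2, N, R with 1 ≤ N ≤ x and 1 ≤ R ≤ x, and every nonzero integer a with |a| < x/N, one has | Σ_{x/N < q ≤ x} ρ_R*(x;q,a) − x · Σ_{s ≤ N} (1/s)(1 − s/N) · Σ_{r ≤ R, r | s} μ(r)² · μ(gcd(r,a)) · φ(gcd(r,a)) / φ(r) | ≤ C·( RN + |a|·(log 2N)² ), where q and s run over positive integers and r over positive integers dividing s. -/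
open Finset Real

theorem abs_card_Ioc_modEq_sub_le_s6 {m : ℕ} (hm : 0 < m) (c : ℕ) {u v : ℝ} (hu : 0 ≤ u)
    (hv : 0 ≤ v) :
    |(#{q ∈ Ioc ⌊u⌋₊ ⌊v⌋₊ | q ≡ c [MOD m]} : ℝ) - max 0 (v - u) / m| ≤ 2 := by
  have hcard := Nat.Ioc_filter_modEq_card ⌊u⌋₊ ⌊v⌋₊ hm c
  have hm' : (1 : ℝ) ≤ m := by exact_mod_cast hm
  have hm0 : (0 : ℝ) < m := by linarith
  set A := ⌊((⌊u⌋₊ : ℚ) - c) / m⌋ with hA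
  set B := ⌊((⌊v⌋₊ : ℚ) - c) / m⌋ with hB
  have hfl (w : ℕ) : (w - c : ℝ) / m - 1 < (⌊((w : ℚ) - c) / m⌋ : ℤ) ∧
      ((⌊((w : ℚ) - c) / m⌋ : ℤ) : ℝ) ≤ (w - c : ℝ) / m := by
    constructor
    · have := Int.sub_one_lt_floor (((w : ℚ) - c) / m)
      exact_mod_cast (Rat.cast_lt (K := ℝ)).2 this
    · have := Int.floor_le (((w : ℚ) - c) / m)
      exact_mod_cast (Rat.cast_le (K := ℝ)).2 this
  have hcard' : (#{q ∈ Ioc ⌊u⌋₊ ⌊v⌋₊ | q ≡ c [MOD m]} : ℝ) = max ((B : ℝ) - A) 0 := by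
    exact_mod_cast congrArg (Int.cast : ℤ → ℝ) hcard
  obtain ⟨hA1, hA2⟩ := hfl ⌊u⌋₊
  obtain ⟨hB1, hB2⟩ := hfl ⌊v⌋₊
  rw [← hA] at hA1 hA2
  rw [← hB] at hB1 hB2
  have hmax : max 0 (v - u) / m = max ((v - u) / m) 0 := by
    rw [max_comm, ← max_div_div_right hm0.le, zero_div]
  rw [hcard', hmax]
  refine (abs_max_sub_max_le_abs _ _ _).trans ?_
  have hu1 := Nat.floor_le hu
  have hu2 := Nat.lt_floor_add_one u
  have hv1 := Nat.floor_le hv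
  have hv2 := Nat.lt_floor_add_one v
  have e1 : ((⌊v⌋₊ : ℝ) - c) / m - (⌊u⌋₊ - c) / m = (⌊v⌋₊ - ⌊u⌋₊) / m := by ring
  have e2 : ((⌊v⌋₊ : ℝ) - ⌊u⌋₊) / m - (v - u) / m ≤ 1 := by
    rw [← sub_div, div_le_one hm0]; linarith
  have e3 : -1 ≤ ((⌊v⌋₊ : ℝ) - ⌊u⌋₊) / m - (v - u) / m := by
    rw [← sub_div, le_div_iff₀ hm0]; linarith
  rw [abs_le]
  constructor <;> linarith

theorem abs_card_Ioc_dvd_add_mul_sub_le {d s : ℕ} (hd : 0 < d) (a : ℤ) {u v : ℝ}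
    (hu : 0 ≤ u) (hv : 0 ≤ v) :
    |(#{q ∈ Ioc ⌊u⌋₊ ⌊v⌋₊ | (d : ℤ) ∣ a + (q : ℕ) * s} : ℝ)
      - max 0 (v - u) * ((if (Nat.gcd d s : ℤ) ∣ a then (Nat.gcd d s : ℝ) else 0) / d)| ≤ 2 := by
  set g := Nat.gcd d s with hg
  have hg0 : 0 < g := Nat.gcd_pos_of_pos_left _ hd
  obtain ⟨d', s', hcop, hdd, hss⟩ := Nat.exists_coprime d s
  rw [← hg] at hdd hss
  have hd' : 0 < d' := Nat.pos_of_ne_zero (by rintro rfl; omega)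
  split_ifs with h
  · have hga : (Int.gcd d s : ℤ) ∣ a := by simpa [hg] using h
    obtain ⟨k, hk⟩ := hga
    have hbez := Int.gcd_eq_gcd_ab d s
    obtain ⟨x, y, hxy⟩ : ∃ x y : ℤ, a = d * x + s * y :=
      ⟨Int.gcdA d s * k, Int.gcdB d s * k, by rw [hk, hbez]; ring⟩
    have hc := Int.emod_nonneg (-y) (b := (d' : ℤ)) (by positivity)
    obtain ⟨c, hc⟩ := Int.eq_ofNat_of_zero_le hc
    have hset : {q ∈ Ioc ⌊u⌋₊ ⌊v⌋₊ | (d : ℤ) ∣ a + (q : ℕ) * s}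
        = {q ∈ Ioc ⌊u⌋₊ ⌊v⌋₊ | q ≡ c [MOD d']} := by
      apply filter_congr
      intro q _
      have h1 : ((q : ℕ) ≡ c [MOD d']) ↔ (d' : ℤ) ∣ q + y := by
        rw [← Int.natCast_modEq_iff, ← hc, Int.modEq_comm, Int.modEq_iff_dvd]
        have h2 : (d' : ℤ) ∣ -y - -y % d' := Int.dvd_self_sub_emod
        rw [show (q : ℤ) - -y % d' = (q + y) + (-y - -y % d') by ring]
        exact dvd_add_left h2
      have h3 : IsCoprime (d' : ℤ) s' := Nat.isCoprime_iff_coprime.2 hcop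
      rw [h1, hxy, show (d : ℤ) * x + s * y + q * s = d * x + s * (q + y) by ring,
        dvd_add_right (dvd_mul_right _ _), hdd, hss]
      push_cast
      rw [mul_right_comm, mul_dvd_mul_iff_right (by positivity)]
      exact ⟨h3.dvd_of_dvd_mul_left, fun h => h.mul_left _⟩
    rw [hset]
    have := abs_card_Ioc_modEq_sub_le_s6 hd' c hu hv
    convert this using 3
    have : (d : ℝ) = d' * g := by exact_mod_cast hdd
    rw [this]
    field_simp
  · have hset : {q ∈ Ioc ⌊u⌋₊ ⌊v⌋₊ | (d : ℤ) ∣ a + (q : ℕ) * s} = ∅ := by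
      apply filter_false_of_mem
      intro q _ hq
      apply h
      have h1 : (g : ℤ) ∣ a + (q : ℕ) * s :=
        (Int.natCast_dvd_natCast.2 (Nat.gcd_dvd_left d s)).trans hq
      have h2 : (g : ℤ) ∣ (q : ℤ) * s := (Int.natCast_dvd_natCast.2 (Nat.gcd_dvd_right d s)).mul_left _
      exact (dvd_add_left h2).1 h1
    rw [hset]; simp

/-- The term of index `r` in `FR R n`. -/
noncomputable def ramanujanTerm (r : ℕ) (n : ℤ) : ℝ :=
  (ArithmeticFunction.moebius r : ℝ) ^ 2 *
    (ArithmeticFunction.moebius (Int.gcd (r : ℤ) n) : ℝ) *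
    (Nat.totient (Int.gcd (r : ℤ) n) : ℝ) / (Nat.totient r : ℝ)

theorem totient_eq_prod_of_squarefree {r : ℕ} (hr : Squarefree r) :
    (r.totient : ℝ) = ∏ p ∈ r.primeFactors, ((p : ℝ) - 1) := by
  have h := Nat.totient_mul_prod_primeFactors r
  rw [Nat.prod_primeFactors_of_squarefree hr, mul_comm] at h
  have h := Nat.eq_of_mul_eq_mul_left (Nat.pos_of_ne_zero hr.ne_zero) h
  rw [h]
  push_cast
  exact prod_congr rfl fun p hp => Nat.cast_pred (Nat.prime_of_mem_primeFactors hp).pos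

theorem moebius_mul_totient_of_squarefree_s6 {g : ℕ} (hg : Squarefree g) :
    (ArithmeticFunction.moebius g : ℝ) * g.totient
      = ∑ d ∈ g.divisors, (ArithmeticFunction.moebius d : ℝ) * d := by
  have h := ArithmeticFunction.IsMultiplicative.prodPrimeFactors_one_sub_of_squarefree
    ((ArithmeticFunction.id : ArithmeticFunction ℕ) : ArithmeticFunction ℝ)
    ArithmeticFunction.isMultiplicative_id.natCast hg
  have h0 : ∀ d : ℕ, ((ArithmeticFunction.id : ArithmeticFunction ℕ) : ArithmeticFunction ℝ) d = d :=
    fun d => by simp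
  simp only [h0] at h
  rw [← h, totient_eq_prod_of_squarefree hg, ArithmeticFunction.moebius_apply_of_squarefree hg,
    ← (ArithmeticFunction.cardDistinctFactors_eq_cardFactors_iff_squarefree hg.ne_zero).2 hg,
    ArithmeticFunction.cardDistinctFactors_apply, ← List.card_toFinset, ← Nat.primeFactors.eq_1]
  push_cast
  rw [← prod_const, ← prod_mul_distrib]
  exact prod_congr rfl fun p _ => by ring

theorem sum_divisors_of_squarefree {r : ℕ} (hr : Squarefree r) :
    ∑ d ∈ r.divisors, (d : ℝ) = ∏ p ∈ r.primeFactors, ((p : ℝ) + 1) := by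
  have h := ArithmeticFunction.IsMultiplicative.prodPrimeFactors_one_add_of_squarefree
    (f := ((ArithmeticFunction.id : ArithmeticFunction ℕ) : ArithmeticFunction ℝ))
    ArithmeticFunction.isMultiplicative_id.natCast hr
  simp only [ArithmeticFunction.natCoe_apply, ArithmeticFunction.id_apply] at h
  rw [← h]
  exact prod_congr rfl fun p _ => by ring

theorem prod_Icc_one_sub_inv_sq (n : ℕ) (hn : 1 ≤ n) :
    ∏ k ∈ Icc 2 n, (1 - 1 / (k : ℝ) ^ 2) = ((n : ℝ) + 1) / (2 * n) := by
  induction n, hn using Nat.le_induction with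
  | base => norm_num
  | succ n hn ih =>
    rw [prod_Icc_succ_top (by omega), ih]
    have : (0 : ℝ) < n := by exact_mod_cast hn
    push_cast
    field_simp
    ring

theorem half_le_prod_one_sub_inv_sq {s : Finset ℕ} (hs : ∀ p ∈ s, 2 ≤ p) :
    1 / 2 ≤ ∏ p ∈ s, (1 - 1 / (p : ℝ) ^ 2) := by
  set n := s.sup id + 1
  have hsub : s ⊆ Icc 2 n := fun p hp => mem_Icc.2 ⟨hs p hp, (le_sup (f := id) hp).trans (by simp [n])⟩
  have hk : ∀ k ∈ Icc 2 n, 0 ≤ 1 - 1 / (k : ℝ) ^ 2 ∧ 1 - 1 / (k : ℝ) ^ 2 ≤ 1 := by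
    intro k hk
    have : (2 : ℝ) ≤ k := by exact_mod_cast (mem_Icc.1 hk).1
    have h1 : 1 / (k : ℝ) ^ 2 ≤ 1 := by rw [div_le_one (by positivity)]; nlinarith
    have h2 : 0 ≤ 1 / (k : ℝ) ^ 2 := by positivity
    constructor <;> linarith
  have h := prod_Icc_one_sub_inv_sq n (by omega)
  have hn : (1 : ℝ) ≤ n := by exact_mod_cast (by omega : 1 ≤ n)
  calc (1 : ℝ) / 2 ≤ ((n : ℝ) + 1) / (2 * n) := by
        rw [div_le_div_iff₀ (by norm_num) (by linarith)]; linarith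
    _ = _ := h.symm
    _ ≤ _ := prod_le_prod_of_subset_of_le_one hsub (fun k h => (hk k h).1) (fun k h _ => (hk k h).2)

theorem sum_divisors_div_totient_le {r : ℕ} (hr : Squarefree r) :
    (∑ d ∈ r.divisors, (d : ℝ)) / r.totient ≤ 2 * (∑ d ∈ r.divisors, 1 / (d : ℝ)) ^ 2 := by
  have hr0 : 0 < r := Nat.pos_of_ne_zero hr.ne_zero
  have hinv : ∑ d ∈ r.divisors, 1 / (d : ℝ) = (∑ d ∈ r.divisors, (d : ℝ)) / r := by
    rw [← Nat.sum_div_divisors r (fun d => 1 / (d : ℝ)), sum_div]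
    refine sum_congr rfl fun d hd => ?_
    rw [Nat.cast_div (Nat.dvd_of_mem_divisors hd) (by have := Nat.pos_of_mem_divisors hd; positivity)]
    simp
  have hprod : (r : ℝ) = ∏ p ∈ r.primeFactors, (p : ℝ) := by
    rw [← Nat.cast_prod, Nat.prod_primeFactors_of_squarefree hr]
  have hφ : (0 : ℝ) < r.totient := by exact_mod_cast Nat.totient_pos.2 hr0
  have hS : 0 < ∑ d ∈ r.divisors, (d : ℝ) :=
    sum_pos (fun d hd => by exact_mod_cast Nat.pos_of_mem_divisors hd) ⟨1, by simp [hr0.ne']⟩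
  have key : (r : ℝ) ^ 2 ≤ 2 * ((∑ d ∈ r.divisors, (d : ℝ)) * r.totient) := by
    have h1 := half_le_prod_one_sub_inv_sq (s := r.primeFactors)
      (fun p hp => (Nat.prime_of_mem_primeFactors hp).two_le)
    have h2 : (∑ d ∈ r.divisors, (d : ℝ)) * r.totient
        = r ^ 2 * ∏ p ∈ r.primeFactors, (1 - 1 / (p : ℝ) ^ 2) := by
      rw [sum_divisors_of_squarefree hr, totient_eq_prod_of_squarefree hr]
      rw [congrArg (· ^ 2) hprod, ← prod_mul_distrib, ← prod_pow, ← prod_mul_distrib]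
      refine prod_congr rfl fun p hp => ?_
      have : (0 : ℝ) < p := by exact_mod_cast (Nat.prime_of_mem_primeFactors hp).pos
      field_simp
      ring
    rw [h2]
    nlinarith [sq_nonneg (r : ℝ)]
  rw [hinv, div_pow, ← mul_div_assoc, div_le_div_iff₀ hφ (by positivity)]
  nlinarith

theorem ramanujanTerm_eq_of_squarefree {r : ℕ} (hr : Squarefree r) (n : ℤ) :
    ramanujanTerm r n
      = (∑ d ∈ r.divisors,
          if (d : ℤ) ∣ n then (ArithmeticFunction.moebius d : ℝ) * d else 0) / r.totient := by
  have hg : Int.gcd r n ∣ r := Int.natCast_dvd_natCast.1 (Int.gcd_dvd_left _ _)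
  have hdiv : (Int.gcd r n).divisors = {d ∈ r.divisors | ((d : ℕ) : ℤ) ∣ n} := by
    ext d
    have hg0 : Int.gcd r n ≠ 0 := fun h => hr.ne_zero (by simpa [h] using hg)
    rw [mem_filter, Nat.mem_divisors, Nat.mem_divisors, Int.dvd_gcd_iff, Int.natCast_dvd_natCast]
    simp [hg0, hr.ne_zero]
  have hμ : (ArithmeticFunction.moebius r : ℝ) ^ 2 = 1 := by
    exact_mod_cast ArithmeticFunction.moebius_sq_eq_one_of_squarefree hr
  rw [ramanujanTerm, hμ, one_mul, moebius_mul_totient_of_squarefree_s6 (hr.squarefree_of_dvd hg), hdiv,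
    sum_filter]

theorem ramanujanTerm_of_not_squarefree {r : ℕ} (hr : ¬Squarefree r) (n : ℤ) :
    ramanujanTerm r n = 0 := by
  simp [ramanujanTerm, ArithmeticFunction.moebius_eq_zero_of_not_squarefree hr]

theorem abs_ramanujanTerm_le_one (r : ℕ) (n : ℤ) : |ramanujanTerm r n| ≤ 1 := by
  have h1 (m : ℕ) : |(ArithmeticFunction.moebius m : ℝ)| ≤ 1 := by
    exact_mod_cast ArithmeticFunction.abs_moebius_le_one
  rcases Nat.eq_zero_or_pos r with rfl | hr
  · simp [ramanujanTerm]
  have hφ : (0 : ℝ) < r.totient := by exact_mod_cast Nat.totient_pos.2 hr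
  have hg : Int.gcd r n ∣ r := Int.natCast_dvd_natCast.1 (Int.gcd_dvd_left _ _)
  have hle : ((Int.gcd r n).totient : ℝ) ≤ r.totient := by
    exact_mod_cast Nat.le_of_dvd (Nat.totient_pos.2 hr) (Nat.totient_dvd_of_dvd hg)
  rw [ramanujanTerm, abs_div, abs_mul, abs_mul, abs_pow, Nat.abs_cast, Nat.abs_cast,
    div_le_one hφ]
  calc _ ≤ (1 : ℝ) ^ 2 * 1 * r.totient := by
        gcongr
        · exact h1 r
        · exact h1 _
    _ = r.totient := by ring

theorem sum_moebius_mul_eq_zero {r p : ℕ} (hr : Squarefree r) (hp : p.Prime) (hpr : p ∣ r)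
    (w : ℕ → ℝ) (hw : ∀ d, w (p * d) = w d) :
    ∑ d ∈ r.divisors, (ArithmeticFunction.moebius d : ℝ) * w d = 0 := by
  have hμ (d : ℕ) (hd : ¬p ∣ d) :
      ArithmeticFunction.moebius (p * d) = -ArithmeticFunction.moebius d := by
    rw [ArithmeticFunction.isMultiplicative_moebius.map_mul_of_coprime
      ((Nat.Prime.coprime_iff_not_dvd hp).2 hd), ArithmeticFunction.moebius_apply_prime hp]
    ring
  have hsplit {d k : ℕ} (hd : d ∣ r) (hk : d = p * k) : ¬p ∣ k := fun h => by
    have h1 : Squarefree (p * k) := hk ▸ hr.squarefree_of_dvd hd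
    exact (Nat.Prime.coprime_iff_not_dvd hp).1 (Nat.coprime_of_squarefree_mul h1) h
  refine sum_involution (fun d _ => if p ∣ d then d / p else p * d) ?_ ?_ ?_ ?_
  · intro d hd
    have hdr := Nat.dvd_of_mem_divisors hd
    split_ifs with h
    · obtain ⟨k, rfl⟩ := h
      rw [Nat.mul_div_cancel_left _ hp.pos, hμ k (hsplit hdr rfl), hw]
      push_cast; ring
    · rw [hμ d h, hw]
      push_cast; ring
  · intro d hd _
    have hd0 := Nat.pos_of_mem_divisors hd
    split_ifs with h
    · exact (Nat.div_lt_self hd0 hp.one_lt).ne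
    · have := hp.one_lt
      nlinarith
  · intro d hd
    have hdr := Nat.dvd_of_mem_divisors hd
    rw [Nat.mem_divisors]
    refine ⟨?_, hr.ne_zero⟩
    split_ifs with h
    · exact (Nat.div_dvd_of_dvd h).trans hdr
    · exact ((Nat.Prime.coprime_iff_not_dvd hp).2 h).mul_dvd_of_dvd_of_dvd hpr hdr
  · intro d hd
    have hdr := Nat.dvd_of_mem_divisors hd
    by_cases h : p ∣ d
    · obtain ⟨k, rfl⟩ := h
      simp [Nat.mul_div_cancel_left _ hp.pos, hsplit hdr rfl]
    · simp [h, Nat.mul_div_cancel_left _ hp.pos]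

theorem sum_moebius_mul_gcd {r s : ℕ} (hr : Squarefree r) (a : ℤ) :
    ∑ d ∈ r.divisors, (ArithmeticFunction.moebius d : ℝ) *
        (if (Nat.gcd d s : ℤ) ∣ a then (Nat.gcd d s : ℝ) else 0)
      = if r ∣ s then ∑ d ∈ r.divisors,
          (if (d : ℤ) ∣ a then (ArithmeticFunction.moebius d : ℝ) * d else 0) else 0 := by
  split_ifs with h
  · refine sum_congr rfl fun d hd => ?_
    rw [Nat.gcd_eq_left ((Nat.dvd_of_mem_divisors hd).trans h), mul_ite, mul_zero]
  · obtain ⟨p, hp, hpr, hps⟩ : ∃ p : ℕ, p.Prime ∧ p ∣ r ∧ ¬p ∣ s := by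
      by_contra! hcon
      apply h
      rw [← Nat.prod_primeFactors_of_squarefree hr]
      exact prod_primes_dvd s (fun p hp => (Nat.prime_of_mem_primeFactors hp).prime)
        fun p hp => hcon p (Nat.prime_of_mem_primeFactors hp) (Nat.dvd_of_mem_primeFactors hp)
    refine sum_moebius_mul_eq_zero hr hp hpr _ fun d => ?_
    rw [Nat.Coprime.gcd_mul_left_cancel d ((Nat.Prime.coprime_iff_not_dvd hp).2 hps)]

theorem abs_sum_ramanujanTerm_sub_le (r s : ℕ) (a : ℤ) {u v : ℝ} (hu : 0 ≤ u) (hv : 0 ≤ v) :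
    |∑ q ∈ Ioc ⌊u⌋₊ ⌊v⌋₊, ramanujanTerm r (a + (q : ℕ) * s)
        - max 0 (v - u) * (if r ∣ s then ramanujanTerm r a else 0)|
      ≤ 4 * (∑ d ∈ r.divisors, 1 / (d : ℝ)) ^ 2 := by
  by_cases hr : Squarefree r
  swap
  · simp only [ramanujanTerm_of_not_squarefree hr, sum_const_zero, ite_self, mul_zero, sub_zero,
      abs_zero]
    positivity
  have hφ : (0 : ℝ) < r.totient := by
    exact_mod_cast Nat.totient_pos.2 (Nat.pos_of_ne_zero hr.ne_zero)
  set w : ℕ → ℝ := fun d => if (Nat.gcd d s : ℤ) ∣ a then (Nat.gcd d s : ℝ) else 0 with hw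
  set c : ℕ → ℝ := fun d => (#{q ∈ Ioc ⌊u⌋₊ ⌊v⌋₊ | (d : ℤ) ∣ a + (q : ℕ) * s} : ℝ) with hc
  have hsum : ∑ q ∈ Ioc ⌊u⌋₊ ⌊v⌋₊, ramanujanTerm r (a + (q : ℕ) * s)
      = (∑ d ∈ r.divisors, (ArithmeticFunction.moebius d : ℝ) * d * c d) / r.totient := by
    simp_rw [ramanujanTerm_eq_of_squarefree hr]
    rw [← sum_div, sum_comm]
    congr 1
    refine sum_congr rfl fun d _ => ?_
    rw [← sum_filter, sum_const, nsmul_eq_mul, mul_comm]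
  have hmain : (if r ∣ s then ramanujanTerm r a else 0)
      = (∑ d ∈ r.divisors, (ArithmeticFunction.moebius d : ℝ) * w d) / r.totient := by
    rw [hw, sum_moebius_mul_gcd hr, ramanujanTerm_eq_of_squarefree hr]
    split_ifs <;> simp
  have hdiff : (∑ d ∈ r.divisors, (ArithmeticFunction.moebius d : ℝ) * d * c d) / r.totient
      - max 0 (v - u) * ((∑ d ∈ r.divisors, (ArithmeticFunction.moebius d : ℝ) * w d) / r.totient)
      = (∑ d ∈ r.divisors, (ArithmeticFunction.moebius d : ℝ) * d *
          (c d - max 0 (v - u) * (w d / d))) / r.totient := by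
    rw [← mul_div_assoc, ← sub_div, mul_sum, ← sum_sub_distrib]
    congr 1
    refine sum_congr rfl fun d hd => ?_
    have : (0 : ℝ) < d := by exact_mod_cast Nat.pos_of_mem_divisors hd
    field_simp
  rw [hsum, hmain, hdiff, abs_div, Nat.abs_cast]
  calc _ ≤ (∑ d ∈ r.divisors, (d : ℝ) * 2) / r.totient := by
        gcongr
        refine (abs_sum_le_sum_abs _ _).trans (sum_le_sum fun d hd => ?_)
        have h1 : |(ArithmeticFunction.moebius d : ℝ)| ≤ 1 := by
          exact_mod_cast ArithmeticFunction.abs_moebius_le_one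
        rw [abs_mul, abs_mul, Nat.abs_cast]
        have h2 := abs_card_Ioc_dvd_add_mul_sub_le (s := s) (Nat.pos_of_mem_divisors hd) a hu hv
        calc _ ≤ 1 * (d : ℝ) * 2 := by gcongr
          _ = d * 2 := by ring
    _ = 2 * ((∑ d ∈ r.divisors, (d : ℝ)) / r.totient) := by rw [← sum_mul]; ring
    _ ≤ 2 * (2 * (∑ d ∈ r.divisors, 1 / (d : ℝ)) ^ 2) := by
        gcongr
        exact sum_divisors_div_totient_le hr
    _ = _ := by ring

theorem divisors_eq_filter_Icc {n r : ℕ} (hr : r ∈ Icc 1 n) :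
    r.divisors = {d ∈ Icc 1 n | d ∣ r} := by
  ext d
  have := mem_Icc.1 hr
  simp only [Nat.mem_divisors, mem_filter, mem_Icc]
  constructor
  · rintro ⟨h, h0⟩
    exact ⟨⟨Nat.pos_of_dvd_of_pos h (by omega), (Nat.le_of_dvd (by omega) h).trans this.2⟩, h⟩
  · rintro ⟨_, h⟩
    exact ⟨h, by omega⟩

theorem exists_sum_sq_sum_divisors_inv_le :
    ∃ K : ℝ, 0 < K ∧ ∀ n : ℕ,
      ∑ r ∈ Icc 1 n, (∑ d ∈ r.divisors, 1 / (d : ℝ)) ^ 2 ≤ K * n := by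
  have hsummable : Summable fun d : ℕ => 1 / (d : ℝ) ^ (3 / 2 : ℝ) :=
    Real.summable_one_div_nat_rpow.2 (by norm_num)
  set Z := ∑' d : ℕ, 1 / (d : ℝ) ^ (3 / 2 : ℝ) with hZ
  have hle (s : Finset ℕ) : ∑ d ∈ s, 1 / (d : ℝ) ^ (3 / 2 : ℝ) ≤ Z :=
    hsummable.sum_le_tsum s fun d _ => by positivity
  have hZ1 : 1 ≤ Z := by simpa using hle {1}
  refine ⟨Z * Z, by positivity, fun n => ?_⟩
  have hmul {d : ℕ} (hd : 0 < d) : (d : ℝ) ^ (3 / 2 : ℝ) = d ^ (1 / 2 : ℝ) * d := by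
    have : (0 : ℝ) < d := by exact_mod_cast hd
    nth_rw 3 [← rpow_one (d : ℝ)]
    rw [← rpow_add this]
    norm_num
  calc ∑ r ∈ Icc 1 n, (∑ d ∈ r.divisors, 1 / (d : ℝ)) ^ 2
      ≤ ∑ r ∈ Icc 1 n, Z * ∑ d ∈ Icc 1 n, if d ∣ r then 1 / (d : ℝ) ^ (1 / 2 : ℝ) else 0 := by
        refine sum_le_sum fun r hr => ?_
        rw [← sum_filter, ← divisors_eq_filter_Icc hr]
        refine (sum_sq_le_sum_mul_sum_of_sq_le_mul (f := fun d : ℕ => 1 / (d : ℝ) ^ (3 / 2 : ℝ))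
          (g := fun d : ℕ => 1 / (d : ℝ) ^ (1 / 2 : ℝ)) _ (fun d _ => by positivity)
          (fun d _ => by positivity) fun d hd => ?_).trans ?_
        · have hd := Nat.pos_of_mem_divisors hd
          have h0 : (0 : ℝ) < d := by exact_mod_cast hd
          have h1 : (d : ℝ) ^ (1 / 2 : ℝ) * d ^ (1 / 2 : ℝ) = d := by
            rw [← rpow_add h0]; norm_num
          refine le_of_eq ?_
          rw [hmul hd, div_pow, div_mul_div_comm, one_pow, one_mul,
            mul_right_comm, h1, sq]
        · gcongr
          exact hle _
    _ = Z * ∑ d ∈ Icc 1 n, (1 / (d : ℝ) ^ (1 / 2 : ℝ)) * (n / d : ℕ) := by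
        rw [← mul_sum, sum_comm]
        congr 1
        refine sum_congr rfl fun d _ => ?_
        rw [← sum_filter, sum_const, nsmul_eq_mul, mul_comm, ← Nat.Ioc_filter_dvd_card_eq_div]
        rfl
    _ ≤ Z * ∑ d ∈ Icc 1 n, n * (1 / (d : ℝ) ^ (3 / 2 : ℝ)) := by
        refine mul_le_mul_of_nonneg_left (sum_le_sum fun d hd => ?_) (by positivity)
        have hd := (mem_Icc.1 hd).1
        have h0 : (0 : ℝ) < d := by exact_mod_cast hd
        rw [hmul hd]
        calc _ ≤ 1 / (d : ℝ) ^ (1 / 2 : ℝ) * (n / d) := by gcongr; exact Nat.cast_div_le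
          _ = _ := by field_simp
    _ ≤ Z * (n * Z) := by
        rw [← mul_sum]
        gcongr
        exact hle _
    _ = _ := by ring

theorem sum_inv_Icc_le (n : ℕ) : ∑ s ∈ Icc 1 n, 1 / (s : ℝ) ≤ 1 + log n := by
  have h := harmonic_le_one_add_log n
  rw [harmonic_eq_sum_Icc] at h
  push_cast at h
  simpa using h

theorem sum_inv_mul_card_divisors_le (n : ℕ) :
    ∑ s ∈ Icc 1 n, 1 / (s : ℝ) * #s.divisors ≤ (1 + log n) ^ 2 := by
  have hlog : 0 ≤ log n := log_natCast_nonneg n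
  calc ∑ s ∈ Icc 1 n, 1 / (s : ℝ) * #s.divisors
      = ∑ s ∈ Icc 1 n, ∑ r ∈ Icc 1 n, if r ∣ s then 1 / (s : ℝ) else 0 := by
        refine sum_congr rfl fun s hs => ?_
        rw [divisors_eq_filter_Icc hs, ← sum_filter, sum_const, nsmul_eq_mul, mul_comm]
    _ = ∑ r ∈ Icc 1 n, ∑ s ∈ Icc 1 n with r ∣ s, 1 / (s : ℝ) := by
        rw [sum_comm]
        simp_rw [sum_filter]
    _ ≤ ∑ r ∈ Icc 1 n, ∑ t ∈ Icc 1 n, 1 / (r : ℝ) * (1 / t) := by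
        refine sum_le_sum fun r hr => ?_
        have hr := (mem_Icc.1 hr).1
        have hsub : {s ∈ Icc 1 n | r ∣ s} ⊆ (Icc 1 n).image (r * ·) := by
          intro s hs
          obtain ⟨hs, t, rfl⟩ := mem_filter.1 hs
          have hs := mem_Icc.1 hs
          refine mem_image.2 ⟨t, mem_Icc.2 ⟨?_, ?_⟩, rfl⟩
          · exact Nat.pos_of_ne_zero (by rintro rfl; simp at hs)
          · nlinarith
        refine (sum_le_sum_of_subset_of_nonneg hsub fun _ _ _ => by positivity).trans ?_
        rw [sum_image fun _ _ _ _ h => Nat.eq_of_mul_eq_mul_left hr h]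
        refine sum_le_sum fun t _ => ?_
        push_cast
        rw [div_mul_div_comm, one_mul]
    _ = (∑ r ∈ Icc 1 n, 1 / (r : ℝ)) ^ 2 := by
        rw [sq, sum_mul_sum]
    _ ≤ _ := by
        gcongr
        exact sum_inv_Icc_le n

theorem rhoStar_eq_sum_Icc {R x N : ℝ} {q : ℕ} {a : ℤ} (hx : 0 < x) (hN : 1 ≤ N)
    (ha : |(a : ℝ)| < x / N) (hq : x / N < q) :
    rhoStar R x q a = ∑ s ∈ Icc 1 (⌊N⌋₊ + 1),
      if (a : ℝ) + q * s ≤ x then FR R (a + (q : ℕ) * (s : ℕ)) else 0 := by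
  obtain ⟨ha1, ha2⟩ := abs_lt.1 ha
  have hq0 : (0 : ℝ) < q := by linarith [abs_nonneg (a : ℝ)]
  have hq0' : 0 < (q : ℤ) := by exact_mod_cast hq0
  have hpos {s : ℕ} (hs : 1 ≤ s) : 0 < a + (q : ℤ) * s := by
    have h1 : (1 : ℝ) ≤ s := by exact_mod_cast hs
    have : (0 : ℝ) < a + q * s := by nlinarith
    exact_mod_cast this
  rw [← sum_filter, rhoStar]
  symm
  refine sum_bij (fun s _ => (a + (q : ℤ) * s).toNat) ?_ ?_ ?_ ?_
  · intro s hs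
    obtain ⟨hs, hsx⟩ := mem_filter.1 hs
    have hs1 := (mem_Icc.1 hs).1
    have hp := hpos hs1
    have hcast : ((a + (q : ℤ) * s).toNat : ℤ) = a + (q : ℤ) * s := Int.toNat_of_nonneg hp.le
    rw [mem_filter, mem_Icc, hcast]
    refine ⟨⟨by omega, Nat.le_floor ?_⟩, ?_, by simp⟩
    · have : ((a + (q : ℤ) * s).toNat : ℝ) = a + q * s := by exact_mod_cast hcast
      rwa [this]
    · have : 0 < (q : ℤ) * s := by positivity
      omega
  · intro s hs t ht hst
    have hs := hpos (mem_Icc.1 (mem_filter.1 hs).1).1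
    have ht := hpos (mem_Icc.1 (mem_filter.1 ht).1).1
    have h : (q : ℤ) * s = q * t := by omega
    exact_mod_cast mul_left_cancel₀ hq0'.ne' h
  · intro n hn
    obtain ⟨hn, han, k, hk⟩ := mem_filter.1 hn
    have hnx : (n : ℝ) ≤ x := (Nat.le_floor_iff hx.le).1 (mem_Icc.1 hn).2
    have hk0 : 0 < k := by
      by_contra! h
      nlinarith
    obtain ⟨s, rfl⟩ := Int.eq_ofNat_of_zero_le hk0.le
    have hns : a + (q : ℤ) * s = n := by linarith
    have hns' : (a : ℝ) + q * s = n := by exact_mod_cast hns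
    refine ⟨s, mem_filter.2 ⟨mem_Icc.2 ⟨by omega, ?_⟩, by rw [hns']; exact hnx⟩, by simp [hns]⟩
    have hu : x / N * N = x := by field_simp
    have h1 : (s : ℝ) < N + 1 := by
      by_contra! h
      have : x / N * (N + 1) ≤ q * s := by gcongr
      linarith
    have h2 := Nat.lt_floor_add_one N
    have h3 : (s : ℝ) < (⌊N⌋₊ + 2 : ℕ) := by push_cast; linarith
    have h4 : s < ⌊N⌋₊ + 2 := by exact_mod_cast h3
    omega
  · intro s hs
    rw [Int.toNat_of_nonneg (hpos (mem_Icc.1 (mem_filter.1 hs).1).1).le]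

theorem sum_rhoStar_eq {R x N : ℝ} {a : ℤ} (hx : 0 < x) (hN : 1 ≤ N)
    (ha : |(a : ℝ)| < x / N) :
    ∑ q ∈ Ioc ⌊x / N⌋₊ ⌊x⌋₊, rhoStar R x q a
      = ∑ s ∈ Icc 1 (⌊N⌋₊ + 1), ∑ r ∈ Icc 1 ⌊R⌋₊,
          ∑ q ∈ Ioc ⌊x / N⌋₊ ⌊min x ((x - a) / (s : ℕ))⌋₊,
            ramanujanTerm r (a + (q : ℕ) * (s : ℕ)) := by
  have hax : (a : ℝ) < x := (le_abs_self _).trans_lt (ha.trans_le (div_le_self hx.le hN))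
  calc _ = ∑ q ∈ Ioc ⌊x / N⌋₊ ⌊x⌋₊, ∑ s ∈ Icc 1 (⌊N⌋₊ + 1),
        if (a : ℝ) + q * s ≤ x then FR R (a + (q : ℕ) * (s : ℕ)) else 0 :=
        sum_congr rfl fun q hq => rhoStar_eq_sum_Icc hx hN ha
          ((Nat.floor_lt (by positivity)).1 (mem_Ioc.1 hq).1)
    _ = _ := by
        rw [sum_comm]
        refine sum_congr rfl fun s hs => ?_
        have hs0 : (0 : ℝ) < s := by exact_mod_cast (mem_Icc.1 hs).1
        rw [sum_comm, ← sum_filter]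
        refine sum_congr ?_ fun q _ => rfl
        ext q
        have hmin : 0 ≤ min x ((x - a) / s) := le_min hx.le (div_nonneg (by linarith) hs0.le)
        rw [mem_filter, mem_Ioc, mem_Ioc, Nat.le_floor_iff hx.le, Nat.le_floor_iff hmin, le_min_iff,
          le_div_iff₀ hs0, le_sub_iff_add_le', and_assoc]

theorem mul_sum_Icc_floor_eq {x N : ℝ} (hx : 0 < x) (hN : 1 ≤ N) (G : ℕ → ℝ) :
    x * ∑ s ∈ Icc 1 ⌊N⌋₊, (1 / (s : ℝ)) * (1 - (s : ℝ) / N) * G s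
      = ∑ s ∈ Icc 1 (⌊N⌋₊ + 1), max 0 (x / s - x / N) * G s := by
  have hN0 : 0 < N := by linarith
  rw [sum_Icc_succ_top (by omega), max_eq_left, zero_mul, add_zero, mul_sum]
  · refine sum_congr rfl fun s hs => ?_
    obtain ⟨hs1, hs2⟩ := mem_Icc.1 hs
    have hs0 : (0 : ℝ) < s := by exact_mod_cast hs1
    have hsN : (s : ℝ) ≤ N := (Nat.le_floor_iff hN0.le).1 hs2
    rw [max_eq_right (sub_nonneg.2 (by gcongr))]
    field_simp
  · have := Nat.lt_floor_add_one N
    push_cast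
    exact sub_nonpos.2 (by gcongr)

theorem abs_max_min_sub_max_le {x u s : ℝ} (hx : 0 < x) (hs : 1 ≤ s) (a : ℝ) :
    |max 0 (min x ((x - a) / s) - u) - max 0 (x / s - u)| ≤ |a| * (1 / s) := by
  have h1 : x / s = min x (x / s) := (min_eq_right (div_le_self hx.le hs)).symm
  rw [h1, max_comm 0, max_comm 0]
  refine (abs_max_sub_max_le_abs _ _ _).trans ?_
  rw [sub_sub_sub_cancel_right, min_comm, min_comm x]
  refine (abs_min_sub_min_le_max _ _ _ _).trans ?_
  rw [sub_self, abs_zero, max_eq_left (abs_nonneg _), ← sub_div, abs_div,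
    abs_of_pos (by linarith : 0 < s), sub_sub_cancel_left, abs_neg, mul_one_div]

theorem one_add_log_floor_add_one_le {N : ℝ} (hN : 1 ≤ N) :
    1 + log (⌊N⌋₊ + 1 : ℕ) ≤ 3 * log (2 * N) := by
  have h1 : log (⌊N⌋₊ + 1 : ℕ) ≤ log (2 * N) := by
    apply log_le_log (by positivity)
    have := Nat.floor_le (by linarith : 0 ≤ N)
    push_cast
    linarith
  have h2 : log 2 ≤ log (2 * N) := log_le_log (by norm_num) (by linarith)
  have := Real.log_two_gt_d9
  linarith

/-- average of `ρ_R*` over large moduli, general form. -/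
theorem rho_large_moduli :
    ∃ C : ℝ, 0 < C ∧ ∀ x N R : ℝ, 2 ≤ x → 1 ≤ N → N ≤ x → 1 ≤ R → R ≤ x →
      ∀ a : ℤ, a ≠ 0 → |(a : ℝ)| < x / N →
      |(∑ q ∈ Finset.Ioc ⌊x / N⌋₊ ⌊x⌋₊, rhoStar R x q a)
          - x * ∑ s ∈ Finset.Icc 1 ⌊N⌋₊, (1 / (s : ℝ)) * (1 - (s : ℝ) / N) *
              ∑ r ∈ (Finset.Icc 1 ⌊R⌋₊).filter (· ∣ s),
                (ArithmeticFunction.moebius r : ℝ) ^ 2 *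
                  (ArithmeticFunction.moebius (Int.gcd (r : ℤ) a) : ℝ) *
                  (Nat.totient (Int.gcd (r : ℤ) a) : ℝ) / (Nat.totient r : ℝ)|
        ≤ C * (R * N + |(a : ℝ)| * Real.log (2 * N) ^ 2) := by
  obtain ⟨K, hK, hKle⟩ := exists_sum_sq_sum_divisors_inv_le
  refine ⟨8 * K + 9, by positivity, fun x N R hx hN _ hR _ a _ ha => ?_⟩
  have hx0 : 0 < x := by linarith
  have hax : (a : ℝ) < x := (le_abs_self _).trans_lt (ha.trans_le (div_le_self hx0.le hN))
  set G : ℕ → ℝ := fun s => ∑ r ∈ (Icc 1 ⌊R⌋₊).filter (· ∣ s), ramanujanTerm r a with hG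
  change |_ - x * ∑ s ∈ Icc 1 ⌊N⌋₊, (1 / (s : ℝ)) * (1 - (s : ℝ) / N) * G s| ≤ _
  rw [mul_sum_Icc_floor_eq hx0 hN G, sum_rhoStar_eq hx0 hN ha]
  set M := ⌊N⌋₊ + 1 with hM
  set v : ℕ → ℝ := fun s => min x ((x - a) / s) with hv
  have hMle : (M : ℝ) ≤ 2 * N := by
    have := Nat.floor_le (by linarith : 0 ≤ N)
    rw [hM]; push_cast; linarith
  have hRle : (⌊R⌋₊ : ℝ) ≤ R := Nat.floor_le (by linarith)
  have hincomplete : ∀ s ∈ Icc 1 M, |∑ r ∈ Icc 1 ⌊R⌋₊, ∑ q ∈ Ioc ⌊x / N⌋₊ ⌊v s⌋₊,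
      ramanujanTerm r (a + (q : ℕ) * (s : ℕ)) - max 0 (v s - x / N) * G s| ≤ 4 * (K * R) := by
    intro s hs
    have hs0 : (0 : ℝ) < s := by exact_mod_cast (mem_Icc.1 hs).1
    simp only [hG]
    rw [sum_filter, mul_sum, ← sum_sub_distrib]
    calc _ ≤ ∑ r ∈ Icc 1 ⌊R⌋₊, 4 * (∑ d ∈ r.divisors, 1 / (d : ℝ)) ^ 2 :=
          (abs_sum_le_sum_abs _ _).trans <| sum_le_sum fun r _ =>
            abs_sum_ramanujanTerm_sub_le r s a (by positivity)
              (le_min hx0.le (div_nonneg (by linarith) hs0.le))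
      _ ≤ 4 * (K * ⌊R⌋₊) := by
          rw [← mul_sum]
          gcongr
          exact hKle _
      _ ≤ _ := by gcongr
  have hlength : ∀ s ∈ Icc 1 M, |max 0 (v s - x / N) * G s - max 0 (x / s - x / N) * G s|
      ≤ |(a : ℝ)| * (1 / (s : ℝ) * #s.divisors) := by
    intro s hs
    have hs1 := (mem_Icc.1 hs).1
    have hG' : |G s| ≤ #s.divisors := by
      calc |G s| ≤ ∑ r ∈ (Icc 1 ⌊R⌋₊).filter (· ∣ s), (1 : ℝ) :=
            (abs_sum_le_sum_abs _ _).trans (sum_le_sum fun r _ => abs_ramanujanTerm_le_one r a)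
        _ ≤ _ := by
            rw [sum_const, nsmul_eq_mul, mul_one, Nat.cast_le]
            refine card_le_card fun r hr => Nat.mem_divisors.2 ⟨(mem_filter.1 hr).2, by omega⟩
    rw [← sub_mul, abs_mul, ← mul_assoc]
    gcongr
    exact abs_max_min_sub_max_le hx0 (by exact_mod_cast hs1) _
  calc _ ≤ ∑ s ∈ Icc 1 M, (4 * (K * R) + |(a : ℝ)| * (1 / (s : ℝ) * #s.divisors)) := by
        rw [← sum_sub_distrib]
        refine (abs_sum_le_sum_abs _ _).trans (sum_le_sum fun s hs => ?_)
        exact (abs_sub_le _ _ _).trans (add_le_add (hincomplete s hs) (hlength s hs))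
    _ = M * (4 * (K * R)) + |(a : ℝ)| * ∑ s ∈ Icc 1 M, 1 / (s : ℝ) * #s.divisors := by
        rw [sum_add_distrib, sum_const, nsmul_eq_mul, Nat.card_Icc, Nat.add_sub_cancel, mul_sum]
    _ ≤ (2 * N) * (4 * (K * R)) + |(a : ℝ)| * (3 * log (2 * N)) ^ 2 := by
        gcongr
        have : 0 ≤ log M := log_natCast_nonneg M
        refine (sum_inv_mul_card_divisors_le M).trans ?_
        gcongr
        exact one_add_log_floor_add_one_le hN
    _ ≤ _ := by
        have h1 : 0 ≤ R * N := by positivity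
        have h2 : 0 ≤ K * (|(a : ℝ)| * log (2 * N) ^ 2) := by positivity
        nlinarith
end
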